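/- Let T' = #·T·$ with sentinels #, $ ∉ Σ. Suppose W is a nonempty string over Σ that is right-maximal in T', and suppose there exists a character a such that aW occurs in T' but aW is not right-maximal in T'. Then W is left-maximal in T', and hence W is a maximal repeat of T'. -/

import Mathlib

/-- Number of (factor) occurrences of `W` in `T`: the number of starting
positions `i` such that `W` is a prefix of `T.drop i`. -/
def occ {α : Type*} [DecidableEq α] (T W : List α) : ℕ :=
  (List.range (T.length + 1)).countP fun i => decide (W <+: T.drop i)

/-- `W` is right-maximal in `T`: at least two distinct right extensions occur. -/
def rightMax {α : Type*} (T W : List α) : Prop :=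
  ∃ b c, b ≠ c ∧ (W ++ [b]) <:+: T ∧ (W ++ [c]) <:+: T

/-- `W` is left-maximal in `T`: at least two distinct left extensions occur. -/
def leftMax {α : Type*} (T W : List α) : Prop :=
  ∃ a c, a ≠ c ∧ (a :: W) <:+: T ∧ (c :: W) <:+: T

/-- implicit Weiner link property. With `T' = # · T · $`, if
`W` (nonempty, over `Σ`) is right-maximal in `T'` and some `aW` occurs in
`T'` without being right-maximal, then `W` is left-maximal, hence a maximal
repeat of `T'`. -/
theorem implicit_weiner_link_maximal_repeat {α : Type*} (T W : List α)
    (hash dol a : α)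
    (hh : hash ∉ T) (hd : dol ∉ T) (hhd : hash ≠ dol)
    (hW : W ≠ []) (hWsig : ∀ x ∈ W, x ≠ hash ∧ x ≠ dol)
    (hrm : rightMax (hash :: T ++ [dol]) W)
    (ha : (a :: W) <:+: (hash :: T ++ [dol]))
    (hnrm : ¬ rightMax (hash :: T ++ [dol]) (a :: W)) :
    leftMax (hash :: T ++ [dol]) W ∧ rightMax (hash :: T ++ [dol]) W := by
  have key : ∀ b, (W ++ [b]) <:+: (hash :: T ++ [dol]) →
      ∃ x, (x :: W ++ [b]) <:+: (hash :: T ++ [dol]) := by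
    rintro b ⟨s, t, h⟩
    rcases List.eq_nil_or_concat s with rfl | ⟨s', x, rfl⟩
    · exfalso
      cases W with
      | nil => exact hW rfl
      | cons w W' =>
        simp only [List.nil_append, List.cons_append, List.cons.injEq] at h
        exact (hWsig w (by simp)).1 h.1
    · exact ⟨x, s', t, by rw [← h]; simp⟩
  refine ⟨?_, hrm⟩
  obtain ⟨b, c, hbc, hb, hc⟩ := hrm
  obtain ⟨x, hx⟩ := key b hb
  obtain ⟨y, hy⟩ := key c hc
  have drop_last : ∀ z d, (z :: W ++ [d]) <:+: (hash :: T ++ [dol]) →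
      (z :: W) <:+: (hash :: T ++ [dol]) := fun z d h =>
    (List.prefix_append (z :: W) [d]).isInfix.trans h
  by_cases hxa : x = a
  · by_cases hya : y = a
    · subst hxa
      subst hya
      exact absurd ⟨b, c, hbc, hx, hy⟩ hnrm
    · exact ⟨y, a, hya, drop_last _ _ hy, ha⟩
  · exact ⟨x, a, hxa, drop_last _ _ hx, ha⟩
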